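/- Yang–Baxter equation, Δ–Δ case (Proposition 2.1 with (X,Y) = (Δ,Δ)): For all x, y ∈ ℂ (with all denominators nonzero), all colors a, b, d, e ∈ {0} ∪ [±n], and all vectors c, f ∈ ℕ^{2n}, the following identity holds: Σ over g, i ∈ {0}∪[±n] and h ∈ ℕ^{2n} of R_{ΔΔ}(a, b, g, i; x, y) · w^Δ_y(g, h, d, c) · w^Δ_x(i, f, e, h) equals Σ over j, l ∈ {0}∪[±n] and k ∈ ℕ^{2n} of w^Δ_x(b, k, j, c) · w^Δ_y(a, f, l, k) · R_{ΔΔ}(l, j, d, e; x, y). (Only finitely many summands are nonzero, by color conservation.) -/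

import Mathlib

open scoped BigOperators

/-- The set of colors `{0} ∪ [±n]`, encoded as `Fin (2*n+1)`:
index `i < n` is the positive color `i+1`, index `n` is the color `0`,
and index `k > n` is the negative color `\overline{2*n+1-k}`.
The order on `Fin (2*n+1)` is exactly the color order
`1 < ⋯ < n < 0 < n̄ < ⋯ < 1̄`. -/
abbrev Col (n : ℕ) := Fin (2*n+1)

/-- The color `0` (identified with the `+` spin). -/
def mid (n : ℕ) : Col n := ⟨n, by omega⟩

/-- The bar involution `i ↦ ī` on colors (fixing `0`). -/
def barC (n : ℕ) (c : Col n) : Col n := ⟨2*n - c.val, by omega⟩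

/-- The positive color `i+1` attached to `i : Fin n`. -/
def posC (n : ℕ) (i : Fin n) : Col n := ⟨i.val, by have := i.isLt; omega⟩

/-- Vectors `I ∈ ℕ^{2n}` indexed by the colors `[±n]` (the entry at the
color `0` is irrelevant/always `0`). -/
abbrev Vec (n : ℕ) := Col n → ℕ

/-- `e_j`: the standard basis vector for `j ∈ [±n]`, and `e_0 = 0`. -/
def eV (n : ℕ) (c : Col n) : Vec n := fun k => if c ≠ mid n ∧ k = c then 1 else 0

/-- `I_{[1,n]}`. -/
def sLo (n : ℕ) (I : Vec n) : ℕ := ∑ k ∈ Finset.univ.filter (fun k : Col n => k < mid n), I k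
/-- `I_{[n̄,1̄]}`. -/
def sHi (n : ℕ) (I : Vec n) : ℕ := ∑ k ∈ Finset.univ.filter (fun k : Col n => mid n < k), I k
/-- `I_{≤ l}`. -/
def sLe (n : ℕ) (I : Vec n) (l : Col n) : ℕ := ∑ k ∈ Finset.univ.filter (fun k : Col n => k ≤ l), I k
/-- `I_{< l}`. -/
def sLt (n : ℕ) (I : Vec n) (l : Col n) : ℕ := ∑ k ∈ Finset.univ.filter (fun k : Col n => k < l), I k
/-- `I_{> l}`. -/
def sGt (n : ℕ) (I : Vec n) (l : Col n) : ℕ := ∑ k ∈ Finset.univ.filter (fun k : Col n => l < k), I k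
/-- `I_{≥ l}`. -/
def sGe (n : ℕ) (I : Vec n) (l : Col n) : ℕ := ∑ k ∈ Finset.univ.filter (fun k : Col n => l ≤ k), I k

/-- The Boltzmann weight `M_x(I, j, K, ℓ)` of a Δ vertex (Table 2.2). -/
noncomputable def MW (n : ℕ) (q s x : ℂ) (I : Vec n) (j : Col n) (K : Vec n) (l : Col n) : ℂ :=
  if ∀ k, I k + eV n j k = K k + eV n l k then
    if j = l then
      if l = mid n then (q ^ (-(sHi n I : ℤ)) - s * x * q ^ (sLo n I : ℤ)) / (1 - s * x)
      else if l < mid n then s * (s * q ^ (I l : ℤ) - x) * q ^ (sLt n I l : ℤ) / (1 - s * x)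
      else (1 - s⁻¹ * x * q ^ (-(I l : ℤ))) * q ^ (-(sGt n I l : ℤ)) / (1 - s * x)
    else if j < l then
      if l = mid n then (q ^ (-(sHi n I : ℤ)) - s ^ 2 * q ^ (sLo n I : ℤ)) / (1 - s * x)
      else if l < mid n then -(s ^ 2) * (1 - q ^ (I l : ℤ)) * q ^ (sLt n I l : ℤ) / (1 - s * x)
      else -(1 - q ^ (I l : ℤ)) * q ^ (-(sGe n I l : ℤ)) / (1 - s * x)
    else
      if l = mid n then x * (s⁻¹ * q ^ (-(sHi n I : ℤ)) - s * q ^ (sLo n I : ℤ)) / (1 - s * x)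
      else if l < mid n then -(s * x) * (1 - q ^ (I l : ℤ)) * q ^ (sLt n I l : ℤ) / (1 - s * x)
      else -(s⁻¹ * x) * (1 - q ^ (I l : ℤ)) * q ^ (-(sGe n I l : ℤ)) / (1 - s * x)
  else 0

/-- Weight of a Δ vertex with west, south, east, north edges `(W, S, E, N)`:
`w^Δ_z(W,S,E,N) = M_z(S, E, N, W)`. -/
noncomputable def wD (n : ℕ) (q s z : ℂ) (W : Col n) (S : Vec n) (E : Col n) (N : Vec n) : ℂ :=
  MW n q s z S E N W

/-- The `Δ-Δ` R-weight `R_{ΔΔ}(α,β,γ,δ; x,y)` (Figure 2.6); positions: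
`α` bottom-left, `β` top-left, `γ` top-right, `δ` bottom-right. -/
noncomputable def RDD (n : ℕ) (q x y : ℂ) (α β γ δ : Col n) : ℂ :=
  if α = β ∧ β = γ ∧ γ = δ then 1
  else if α = γ ∧ β = δ ∧ α < β then (y - x) / (y - q * x)
  else if α = γ ∧ β = δ ∧ β < α then q * (y - x) / (y - q * x)
  else if α = δ ∧ β = γ ∧ β < α then (1 - q) * x / (y - q * x)
  else if α = δ ∧ β = γ ∧ α < β then (1 - q) * y / (y - q * x)
  else 0

/-- The point of the potential just before the color `l`. -/
noncomputable def pF (n : ℕ) (q s : ℂ) (I : Vec n) (l : Col n) : ℂ :=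
  if l ≤ mid n then s ^ 2 * q ^ (sLt n I l : ℤ) else q ^ (-(sGe n I l : ℤ))

/-- The point of the potential just after the color `l`. -/
noncomputable def pG (n : ℕ) (q s : ℂ) (I : Vec n) (l : Col n) : ℂ :=
  if l < mid n then s ^ 2 * q ^ (sLe n I l : ℤ) else q ^ (-(sGt n I l : ℤ))

/-- Uniform (unnormalized) vertex weight. -/
noncomputable def mm {n : ℕ} (u F G : ℂ) (j l : Col n) : ℂ :=
  if j < l then G - F else if j = l then G - u * F else u * (G - F)

/-- Shift factor of `pF`. -/
noncomputable def shF {n : ℕ} (q : ℂ) (e i l : Col n) : ℂ :=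
  if e < l ∧ l ≤ i then q else if i < l ∧ l ≤ e then q⁻¹ else 1

/-- Shift factor of `pG`. -/
noncomputable def shG {n : ℕ} (q : ℂ) (e i l : Col n) : ℂ :=
  if e ≤ l ∧ l < i then q else if i ≤ l ∧ l < e then q⁻¹ else 1

lemma sLe_eq (n : ℕ) (I : Vec n) (l : Col n) : sLe n I l = sLt n I l + I l := by
  unfold sLe sLt
  have : Finset.univ.filter (fun k : Col n => k ≤ l)
      = insert l (Finset.univ.filter (fun k : Col n => k < l)) := by
    ext k; simp [le_iff_lt_or_eq, or_comm]
  rw [this, Finset.sum_insert (by simp)]; ring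

lemma sGe_eq (n : ℕ) (I : Vec n) (l : Col n) : sGe n I l = sGt n I l + I l := by
  unfold sGe sGt
  have : Finset.univ.filter (fun k : Col n => l ≤ k)
      = insert l (Finset.univ.filter (fun k : Col n => l < k)) := by
    ext k; simp [le_iff_lt_or_eq, or_comm, eq_comm]
  rw [this, Finset.sum_insert (by simp)]; ring

lemma MW_eq (n : ℕ) (q s x : ℂ) (hq : q ≠ 0) (hs : s ≠ 0) (I : Vec n) (j : Col n) (K : Vec n)
    (l : Col n) : MW n q s x I j K l =
      if ∀ k, I k + eV n j k = K k + eV n l k then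
        mm (x / s) (pF n q s I l) (pG n q s I l) j l / (1 - s * x) else 0 := by
  unfold MW
  by_cases h0 : ∀ k, I k + eV n j k = K k + eV n l k
  · rw [if_pos h0, if_pos h0]
    unfold mm pF pG
    have hLo : sLt n I (mid n) = sLo n I := rfl
    have hHi : sGt n I (mid n) = sHi n I := rfl
    rcases lt_trichotomy l (mid n) with hl | hl | hl
    · have h1 : l ≠ mid n := hl.ne
      have h2 : l ≤ mid n := hl.le
      rcases lt_trichotomy j l with h | h | h
      · simp only [h, h.ne, h1, h2, hl, if_true, if_false, sLe_eq, Nat.cast_add, zpow_add₀ hq]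
        congr 1; ring
      · subst h
        simp only [lt_irrefl, h1, h2, hl, if_true, if_false, sLe_eq, Nat.cast_add, zpow_add₀ hq]
        congr 1; field_simp
      · simp only [h.not_gt, h.ne', h1, h2, hl, if_true, if_false, sLe_eq, Nat.cast_add,
          zpow_add₀ hq]
        congr 1; field_simp; ring
    · subst hl
      rcases lt_trichotomy j (mid n) with h | h | h
      · simp only [h, h.ne, le_refl, lt_irrefl, if_true, if_false, hLo, hHi]
      · subst h
        simp only [le_refl, lt_irrefl, if_true, if_false, hLo, hHi]
        congr 1; field_simp
      · simp only [h.not_gt, h.ne', le_refl, lt_irrefl, if_true, if_false, hLo, hHi]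
        congr 1; field_simp
    · have h1 : l ≠ mid n := hl.ne'
      have h2 : ¬ l ≤ mid n := not_le.mpr hl
      have h3 : ¬ l < mid n := hl.not_gt
      have hz : q ^ (I l : ℤ) ≠ 0 := zpow_ne_zero _ hq
      have hz' : q ^ (sGt n I l : ℤ) ≠ 0 := zpow_ne_zero _ hq
      rcases lt_trichotomy j l with h | h | h
      · simp only [h, h.ne, h1, h2, h3, if_true, if_false, sGe_eq, Nat.cast_add, zpow_neg,
          zpow_add₀ hq]
        congr 1; field_simp; ring
      · subst h
        simp only [lt_irrefl, h1, h2, h3, if_true, if_false, sGe_eq, Nat.cast_add, zpow_neg,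
          zpow_add₀ hq]
        congr 1; field_simp
      · simp only [h.not_gt, h.ne', h1, h2, h3, if_false, sGe_eq, Nat.cast_add, zpow_neg,
          zpow_add₀ hq]
        congr 1; field_simp; ring
  · rw [if_neg h0, if_neg h0]

lemma sum_shift (n : ℕ) (f h : Vec n) (e i : Col n)
    (H : ∀ k, f k + eV n e k = h k + eV n i k) (P : Col n → Prop) [DecidablePred P] :
    (∑ k ∈ Finset.univ.filter P, f k) + (if e ≠ mid n ∧ P e then 1 else 0)
      = (∑ k ∈ Finset.univ.filter P, h k) + (if i ≠ mid n ∧ P i then 1 else 0) := by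
  have key : ∀ c : Col n, ∑ k ∈ Finset.univ.filter P, eV n c k
      = (if c ≠ mid n ∧ P c then 1 else 0) := by
    intro c
    unfold eV
    by_cases hc : c = mid n <;> simp [hc]
  rw [← key, ← key, ← Finset.sum_add_distrib, ← Finset.sum_add_distrib]
  exact Finset.sum_congr rfl (fun k _ => H k)

lemma zpow_aux (q : ℂ) (hq : q ≠ 0) (m k : ℤ) (r : ℂ) 
    (H : (m = k ∧ r = 1) ∨ (m = k + 1 ∧ r = q) ∨ (m = k - 1 ∧ r = q⁻¹)) :
    q ^ m = q ^ k * r := by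
  rcases H with ⟨rfl, rfl⟩ | ⟨rfl, rfl⟩ | ⟨rfl, rfl⟩
  · simp
  · rw [zpow_add_one₀ hq]
  · rw [zpow_sub_one₀ hq]

lemma pF_shift (n : ℕ) (q s : ℂ) (hq : q ≠ 0) (f h : Vec n) (e i l : Col n)
    (H : ∀ k, f k + eV n e k = h k + eV n i k) :
    pF n q s h l = pF n q s f l * shF q e i l := by
  unfold pF shF
  split_ifs with h0 h1 h2 h3 h4 <;> (try rw [mul_assoc]) <;> (try congr 1) <;>
    apply zpow_aux q hq <;> 
    (first
      | have := sum_shift n f h e i H (fun k => k < l)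
        change sLt n f l + _ = sLt n h l + _ at this
        simp only [ne_eq, Fin.ext_iff, Fin.lt_def, Fin.le_def, mid] at *
        split_ifs at this <;> simp <;> omega
      | have := sum_shift n f h e i H (fun k => l ≤ k)
        change sGe n f l + _ = sGe n h l + _ at this
        simp only [ne_eq, Fin.ext_iff, Fin.lt_def, Fin.le_def, mid] at *
        split_ifs at this <;> simp <;> omega)

lemma pG_shift (n : ℕ) (q s : ℂ) (hq : q ≠ 0) (f h : Vec n) (e i l : Col n)
    (H : ∀ k, f k + eV n e k = h k + eV n i k) :
    pG n q s h l = pG n q s f l * shG q e i l := by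
  unfold pG shG
  split_ifs with h0 h1 h2 h3 h4 <;> (try rw [mul_assoc]) <;> (try congr 1) <;>
    apply zpow_aux q hq <;> 
    (first
      | have := sum_shift n f h e i H (fun k => k ≤ l)
        change sLe n f l + _ = sLe n h l + _ at this
        simp only [ne_eq, Fin.ext_iff, Fin.lt_def, Fin.le_def, mid] at *
        split_ifs at this <;> simp <;> omega
      | have := sum_shift n f h e i H (fun k => l < k)
        change sGt n f l + _ = sGt n h l + _ at this
        simp only [ne_eq, Fin.ext_iff, Fin.lt_def, Fin.le_def, mid] at *
        split_ifs at this <;> simp <;> omega)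

lemma mm_vanish (n : ℕ) (q s u : ℂ) (f : Vec n) (e i : Col n)
    (H : ¬ ∃ h : Vec n, ∀ k, f k + eV n e k = h k + eV n i k) :
    mm u (pF n q s f i) (pG n q s f i) e i = 0 := by
  have hei : e ≠ i := by
    rintro rfl; exact H ⟨f, fun k => rfl⟩
  have hi : i ≠ mid n := by
    rintro rfl; exact H ⟨fun k => f k + eV n e k, fun k => by simp [eV]⟩
  have hfi : f i = 0 := by
    by_contra h0
    apply H
    refine ⟨fun k => f k + eV n e k - eV n i k, fun k => ?_⟩
    by_cases hk : k = i
    · subst hk; simp [eV, hi, hei.symm]; omega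
    · simp [eV, hk]
  have : pG n q s f i = pF n q s f i := by
    unfold pF pG
    rw [sLe_eq, sGe_eq, hfi]
    rcases lt_or_gt_of_ne hi with h | h
    · simp [h, h.le]
    · simp [h.not_gt, not_le.mpr h]
  unfold mm
  rw [this]; simp [hei]

/-- The two-vertex weight. -/
noncomputable def TT (n : ℕ) (q s y x : ℂ) (f : Vec n) (e i d g : Col n) : ℂ :=
  mm (y / s) (pF n q s f g * shF q e i g) (pG n q s f g * shG q e i g) d g *
    mm (x / s) (pF n q s f i) (pG n q s f i) e i / ((1 - s * x) * (1 - s * y))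

lemma finsum_MW (n : ℕ) (q s y x : ℂ) (hq : q ≠ 0) (hs : s ≠ 0) (f c : Vec n)
    (e i d g : Col n) :
    ∑ᶠ h : Vec n, MW n q s y h d c g * MW n q s x f e h i =
      if ∀ k, f k + eV n e k + eV n d k = c k + eV n i k + eV n g k then
        TT n q s y x f e i d g else 0 := by
  by_cases H : ∃ h : Vec n, ∀ k, f k + eV n e k = h k + eV n i k
  · obtain ⟨h, hh⟩ := H
    rw [finsum_eq_single _ h]
    · rw [MW_eq n q s y hq hs, MW_eq n q s x hq hs, if_pos hh, pF_shift n q s hq f h e i g hh,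
        pG_shift n q s hq f h e i g hh]
      have : (∀ k, h k + eV n d k = c k + eV n g k) ↔
          ∀ k, f k + eV n e k + eV n d k = c k + eV n i k + eV n g k := by
        refine forall_congr' fun k => ?_
        have := hh k
        omega
      by_cases hC : ∀ k, h k + eV n d k = c k + eV n g k
      · rw [if_pos hC, if_pos (this.mp hC)]
        unfold TT
        rw [div_mul_div_comm, mul_comm (1 - s * y)]
      · rw [if_neg hC, if_neg (fun h' => hC (this.mpr h')), zero_mul]
    · intro h' hne
      rw [MW_eq n q s x hq hs, if_neg, mul_zero]
      intro h2
      apply hne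
      funext k
      have := h2 k
      have := hh k
      omega
  · have hz : ∀ h : Vec n, MW n q s y h d c g * MW n q s x f e h i = 0 := by
      intro h
      rw [MW_eq n q s x hq hs, if_neg (fun h' => H ⟨h, h'⟩), mul_zero]
    simp only [hz, finsum_zero]
    unfold TT
    rw [mm_vanish n q s _ f e i H]
    simp

lemma RDD_eq_zero (n : ℕ) (q x y : ℂ) (a b g i : Col n)
    (h1 : ¬ (g = a ∧ i = b)) (h2 : ¬ (g = b ∧ i = a)) : RDD n q x y a b g i = 0 := by
  unfold RDD
  rw [if_neg, if_neg, if_neg, if_neg, if_neg]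
  all_goals grind

lemma sum_two {ι : Type*} [Fintype ι] [DecidableEq ι] (a b : ι) (F : ι → ι → ℂ)
    (hF : ∀ g i, ¬ (g = a ∧ i = b) → ¬ (g = b ∧ i = a) → F g i = 0) :
    ∑ g, ∑ i, F g i = F a b + (if a = b then 0 else F b a) := by
  rw [← Finset.sum_product' (f := F)]
  have h1 : ∑ p ∈ (Finset.univ ×ˢ Finset.univ : Finset (ι × ι)), F p.1 p.2
      = ∑ p ∈ ({(a, b), (b, a)} : Finset (ι × ι)), F p.1 p.2 := by
    symm
    apply Finset.sum_subset (by simp)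
    rintro ⟨g, i⟩ - hp
    simp only [Finset.mem_insert, Finset.mem_singleton, Prod.mk.injEq, not_or] at hp
    exact hF g i hp.1 hp.2
  rw [h1]
  by_cases hab : a = b
  · subst hab; simp
  · rw [Finset.sum_pair (by simp [hab]), if_neg hab]

lemma RDD_eq_zero' (n : ℕ) (q x y : ℂ) (d e j l : Col n)
    (h1 : ¬ (j = d ∧ l = e)) (h2 : ¬ (j = e ∧ l = d)) : RDD n q x y l j d e = 0 :=
  RDD_eq_zero n q x y l j d e (fun h => h2 ⟨h.2.symm, h.1.symm⟩)
    (fun h => h1 ⟨h.1.symm, h.2.symm⟩)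

lemma tri {n : ℕ} (a b : Col n) :
    (a < b ∧ a ≤ b ∧ a ≠ b ∧ b ≠ a ∧ ¬ b < a ∧ ¬ b ≤ a) ∨ a = b ∨
    (b < a ∧ b ≤ a ∧ b ≠ a ∧ a ≠ b ∧ ¬ a < b ∧ ¬ a ≤ b) := by
  rcases lt_trichotomy a b with h | h | h
  · exact Or.inl ⟨h, h.le, h.ne, h.ne', h.not_gt, h.not_ge⟩
  · exact Or.inr (Or.inl h)
  · exact Or.inr (Or.inr ⟨h, h.le, h.ne, h.ne', h.not_gt, h.not_ge⟩)

set_option maxHeartbeats 4000000 in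
lemma core (n : ℕ) (q s x y : ℂ)
    (hq : q ≠ 0) (hs : s ≠ 0) (hx : 1 - s * x ≠ 0) (hy : 1 - s * y ≠ 0)
    (hR : y - q * x ≠ 0) (a b d e : Col n) (f : Vec n) :
    RDD n q x y a b a b * TT n q s y x f e b d a
      + (if a = b then 0 else RDD n q x y a b b a * TT n q s y x f e a d b)
    = TT n q s x y f e a d b * RDD n q x y e d d e
      + (if d = e then 0 else TT n q s x y f d a e b * RDD n q x y d e d e) := by
  unfold TT
  obtain ⟨u, rfl⟩ : ∃ u, x = s * u := ⟨x / s, by field_simp⟩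
  obtain ⟨v, rfl⟩ : ∃ v, y = s * v := ⟨y / s, by field_simp⟩
  rw [mul_div_cancel_left₀ _ hs, mul_div_cancel_left₀ _ hs]
  have hR' : v - q * u ≠ 0 := by
    intro h; apply hR; linear_combination s * h
  have e1 : ∀ A : ℂ, A / ((1 - s * (s * u)) * (1 - s * (s * v))) =
    A * ((1 - s * (s * u)) * (1 - s * (s * v)))⁻¹ := fun A => div_eq_mul_inv _ _
  rw [mul_comm (1 - s * (s * v))]
  simp only [e1]
  generalize ((1 - s * (s * u)) * (1 - s * (s * v)))⁻¹ = N
  have r1 : (s * v - s * u) / (s * v - q * (s * u)) = (v - u) / (v - q * u) := by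
    rw [← mul_div_mul_left _ (v - q * u) hs]; ring_nf
  have r2 : q * (s * v - s * u) / (s * v - q * (s * u)) = q * (v - u) / (v - q * u) := by
    rw [← mul_div_mul_left _ (v - q * u) hs]; ring_nf
  have r3 : (1 - q) * (s * u) / (s * v - q * (s * u)) = (1 - q) * u / (v - q * u) := by
    rw [← mul_div_mul_left _ (v - q * u) hs]; ring_nf
  have r4 : (1 - q) * (s * v) / (s * v - q * (s * u)) = (1 - q) * v / (v - q * u) := by
    rw [← mul_div_mul_left _ (v - q * u) hs]; ring_nf
  unfold RDD
  rw [r1, r2, r3, r4]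
  clear r1 r2 r3 r4 e1 hx hy hR
  obtain ⟨t, rfl⟩ : ∃ t, v = t + q * u := ⟨v - q * u, by ring⟩
  rw [add_sub_cancel_right] at hR' ⊢
  unfold mm shF shG
  rcases tri a b with ⟨h1, h2, h3, h4, h5, h6⟩ | h1 | ⟨h1, h2, h3, h4, h5, h6⟩ <;>
  rcases tri d e with ⟨k1, k2, k3, k4, k5, k6⟩ | k1 | ⟨k1, k2, k3, k4, k5, k6⟩ <;>
  rcases tri a d with ⟨l1, l2, l3, l4, l5, l6⟩ | l1 | ⟨l1, l2, l3, l4, l5, l6⟩ <;>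
  rcases tri a e with ⟨m1, m2, m3, m4, m5, m6⟩ | m1 | ⟨m1, m2, m3, m4, m5, m6⟩ <;>
  (try (exfalso; order)) <;>
  rcases tri b d with ⟨o1, o2, o3, o4, o5, o6⟩ | o1 | ⟨o1, o2, o3, o4, o5, o6⟩ <;>
  (try (exfalso; order)) <;>
  rcases tri b e with ⟨p1, p2, p3, p4, p5, p6⟩ | p1 | ⟨p1, p2, p3, p4, p5, p6⟩ <;>
  (try (exfalso; order)) <;>
  subst_vars <;>
  simp only [*, lt_irrefl, le_refl, if_true, if_false, and_true, and_false,
    and_self] <;>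
  field_simp <;> ring

/-- Yang–Baxter equation, Δ–Δ case. -/
theorem yang_baxter_delta_delta (n : ℕ) (hn : 0 < n) (q s x y : ℂ)
    (hq : q ≠ 0) (hs : s ≠ 0) (hx : 1 - s * x ≠ 0) (hy : 1 - s * y ≠ 0)
    (hR : y - q * x ≠ 0)
    (a b d e : Col n) (c f : Vec n) :
    ∑ g : Col n, ∑ i : Col n, ∑ᶠ h : Vec n,
        RDD n q x y a b g i * wD n q s y g h d c * wD n q s x i f e h
      = ∑ j : Col n, ∑ l : Col n, ∑ᶠ k : Vec n,
        wD n q s x b k j c * wD n q s y a f l k * RDD n q x y l j d e := by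
  unfold wD
  simp only [mul_assoc (RDD n q x y a b _ _), ← mul_finsum, ← finsum_mul,
    finsum_MW n q s _ _ hq hs]
  rw [sum_two a b _ (fun g i h1 h2 => by rw [RDD_eq_zero n q x y a b g i h1 h2, zero_mul]),
    sum_two d e _ (fun j l h1 h2 => by rw [RDD_eq_zero' n q x y d e j l h1 h2, mul_zero])]
  by_cases hC : ∀ k, f k + eV n e k + eV n d k = c k + eV n a k + eV n b k
  · have h1 : ∀ k, f k + eV n e k + eV n d k = c k + eV n b k + eV n a k :=
      fun k => by have := hC k; omega
    have h2 : ∀ k, f k + eV n d k + eV n e k = c k + eV n a k + eV n b k :=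
      fun k => by have := hC k; omega
    rw [if_pos hC, if_pos h1, if_pos h2, if_pos hC]
    have := core n q s x y hq hs hx hy hR a b d e f
    exact this
  · have h1 : ¬ ∀ k, f k + eV n e k + eV n d k = c k + eV n b k + eV n a k :=
      fun h => hC fun k => by have := h k; omega
    have h2 : ¬ ∀ k, f k + eV n d k + eV n e k = c k + eV n a k + eV n b k :=
      fun h => hC fun k => by have := h k; omega
    rw [if_neg hC, if_neg h1, if_neg h2, if_neg hC]
    simp
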